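/- arXiv:2306.08153 — 4 statements merged into one kernel-verified Lean document; each statement's English description precedes it below -/
import Mathlib

section
/- Let X be an n×n real symmetric positive definite matrix that is b̂-banded, i.e., X[i,j] = 0 whenever |i − j| ≥ b̂. Then there exists a lower-triangular b̂-banded matrix C ∈ ℝ^{n×n} (C[i,j] = 0 whenever i < j or |i − j| ≥ b̂) such that CᵀC = X. -/
open Matrix

/-- A matrix `M` is `b`-banded if `M i j = 0` whenever `|i - j| ≥ b`. -/
def IsBanded {n : ℕ} (b : ℕ) (M : Matrix (Fin n) (Fin n) ℝ) : Prop :=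
  ∀ i j : Fin n, (b : ℤ) ≤ |((i : ℕ) : ℤ) - ((j : ℕ) : ℤ)| → M i j = 0

/-- A matrix `M` is lower triangular if `M i j = 0` whenever `i < j`. -/
def IsLowerTriangular {n : ℕ} (M : Matrix (Fin n) (Fin n) ℝ) : Prop :=
  ∀ i j : Fin n, i < j → M i j = 0

/-- One elimination step preserves positive definiteness. -/
theorem schur_step {n : ℕ} (X : Matrix (Fin (n+1)) (Fin (n+1)) ℝ) (hX : X.PosDef) :
    (Matrix.of fun i j : Fin n => X i.castSucc j.castSucc
      - X (Fin.last n) i.castSucc * X (Fin.last n) j.castSucc / X (Fin.last n) (Fin.last n)).PosDef := by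
  have hd : 0 < X (Fin.last n) (Fin.last n) := hX.diag_pos
  have hsym : ∀ i j, X i j = X j i := fun i j => by
    simpa using (hX.isHermitian.apply i j).symm
  let B : Matrix (Fin (n+1)) (Fin n) ℝ := Matrix.of fun k j =>
    Fin.lastCases (motive := fun _ => ℝ)
      (-(X (Fin.last n) j.castSucc / X (Fin.last n) (Fin.last n)))
      (fun i => (1 : Matrix (Fin n) (Fin n) ℝ) i j) k
  have hBc : ∀ i j, B (Fin.castSucc i) j = (1 : Matrix (Fin n) (Fin n) ℝ) i j := by
    intro i j; simp [B]
  have hBl : ∀ j, B (Fin.last n) j = -(X (Fin.last n) j.castSucc / X (Fin.last n) (Fin.last n)) := by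
    intro j; simp [B]
  have hinj : Function.Injective B.mulVec := by
    intro y z h
    funext i
    have := congrFun h i.castSucc
    simpa [Matrix.mulVec, dotProduct, hBc, Matrix.one_apply] using this
  have key := hX.conjTranspose_mul_mul_same hinj
  convert key using 1
  ext i j
  simp only [Matrix.mul_apply, Matrix.of_apply, Matrix.conjTranspose_apply, star_trivial,
    Fin.sum_univ_castSucc, hBc, hBl, Matrix.one_apply]
  simp
  rw [hsym i.castSucc (Fin.last n)]
  field_simp
  ring

/-- Every symmetric positive definite `b̂`-banded matrix `X` admits a
factorization `X = Cᵀ C` where `C` is lower triangular and `b̂`-banded. -/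
theorem banded_cholesky {n : ℕ} (bhat : ℕ) (hbhat : 0 < bhat)
    (X : Matrix (Fin n) (Fin n) ℝ) (hX : X.PosDef) (hXband : IsBanded bhat X) :
    ∃ C : Matrix (Fin n) (Fin n) ℝ,
      _root_.IsLowerTriangular C ∧ IsBanded bhat C ∧ Cᵀ * C = X := by
  induction n with
  | zero => exact ⟨0, fun i => i.elim0, fun i => i.elim0, by ext i; exact i.elim0⟩
  | succ n ih =>
    have hd : 0 < X (Fin.last n) (Fin.last n) := hX.diag_pos
    have hsym : ∀ i j, X i j = X j i := fun i j => by
      simpa using (hX.isHermitian.apply i j).symm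
    obtain ⟨C, hl, hb, hC⟩ := ih _ (schur_step X hX) (by
      intro i j hij
      have h1 : X i.castSucc j.castSucc = 0 := hXband _ _ (by simpa using hij)
      have h2 : X (Fin.last n) i.castSucc * X (Fin.last n) j.castSucc = 0 := by
        have := i.isLt
        have := j.isLt
        rcases le_total (i : ℕ) (j : ℕ) with h | h
        · rw [hXband (Fin.last n) i.castSucc (by simp only [Fin.val_last, Fin.val_castSucc]; grind), zero_mul]
        · rw [hXband (Fin.last n) j.castSucc (by simp only [Fin.val_last, Fin.val_castSucc]; grind), mul_zero]
      simp [h1, h2])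
    have hs : √(X (Fin.last n) (Fin.last n)) * √(X (Fin.last n) (Fin.last n))
      = X (Fin.last n) (Fin.last n) := Real.mul_self_sqrt hd.le
    have hs0 : √(X (Fin.last n) (Fin.last n)) ≠ 0 := (Real.sqrt_pos.2 hd).ne'
    let D : Matrix (Fin (n+1)) (Fin (n+1)) ℝ := Matrix.of fun k j =>
      Fin.lastCases (motive := fun _ => ℝ)
        (X (Fin.last n) j / √(X (Fin.last n) (Fin.last n)))
        (fun i => Fin.lastCases (motive := fun _ => ℝ) 0 (fun jj => C i jj) j) k
    have hDl : ∀ j, D (Fin.last n) j = X (Fin.last n) j / √(X (Fin.last n) (Fin.last n)) := by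
      intro j; simp [D]
    have hDcl : ∀ i : Fin n, D i.castSucc (Fin.last n) = 0 := by
      intro i; simp [D]
    have hDcc : ∀ i j : Fin n, D i.castSucc j.castSucc = C i j := by
      intro i j; simp [D]
    refine ⟨D, ?_, ?_, ?_⟩
    · intro i j hij
      induction i using Fin.lastCases with
      | last => exact absurd hij (not_lt.2 (Fin.le_last j))
      | cast i =>
        induction j using Fin.lastCases with
        | last => exact hDcl i
        | cast j => rw [hDcc]; exact hl i j (by simpa using hij)
    · intro i j hij
      induction i using Fin.lastCases with
      | last => rw [hDl, hXband _ _ hij, zero_div]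
      | cast i =>
        induction j using Fin.lastCases with
        | last => exact hDcl i
        | cast j => rw [hDcc]; exact hb i j (by simpa using hij)
    · ext i j
      have hmul : ∀ a b : ℝ, a / √(X (Fin.last n) (Fin.last n)) * (b / √(X (Fin.last n) (Fin.last n)))
          = a * b / X (Fin.last n) (Fin.last n) := by
        intro a b; rw [div_mul_div_comm, hs]
      simp only [Matrix.mul_apply, Matrix.transpose_apply, Fin.sum_univ_castSucc, hDl, hmul]
      induction i using Fin.lastCases with
      | last => simp [hDcl, hd.ne']
      | cast i =>
        induction j using Fin.lastCases with
        | last => simp [hDcl, hd.ne', hsym i.castSucc (Fin.last n)]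
        | cast j =>
          have := congrFun (congrFun hC i) j
          simp only [Matrix.mul_apply, Matrix.transpose_apply, Matrix.of_apply] at this
          simp only [hDcc, this]
          ring
end

section
/- Let C ∈ ℝ^{n×n} be lower-triangular and b-banded, and let π ⊆ {1,…,n} be a set with min-separation at least b, i.e., any two distinct i, j ∈ π satisfy |i − j| ≥ b. Then the squared Euclidean norm of the sum of the columns of C indexed by π equals the sum of the squared column norms: ‖Σ_{i∈π} C[:,i]‖² = Σ_{i∈π} ‖C[:,i]‖². -/
open Matrix

/-- A set of indices has min-separation at least `b` if any two distinct elements are at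
distance at least `b`. -/
def MinSep {n : ℕ} (b : ℕ) (π : Finset (Fin n)) : Prop :=
  ∀ i ∈ π, ∀ j ∈ π, i ≠ j → (b : ℤ) ≤ |((i : ℕ) : ℤ) - ((j : ℕ) : ℤ)|

/-- For a lower-triangular `b`-banded matrix `C` and a participation
pattern `π` with min-separation at least `b`, the squared norm of the sum of the columns
of `C` indexed by `π` equals the sum of the squared column norms. -/
theorem banded_column_sum_norm {n : ℕ} (b : ℕ) (hb : 0 < b)
    (C : Matrix (Fin n) (Fin n) ℝ) (hlow : _root_.IsLowerTriangular C) (hband : IsBanded b C)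
    (π : Finset (Fin n)) (hπ : MinSep b π) :
    ∑ r : Fin n, (∑ i ∈ π, C r i) ^ 2 = ∑ i ∈ π, ∑ r : Fin n, (C r i) ^ 2 := by
  rw [Finset.sum_comm]
  refine Finset.sum_congr rfl fun r _ => ?_
  rw [sq, Finset.sum_mul_sum]
  refine Finset.sum_congr rfl fun i hi => ?_
  rw [Finset.sum_eq_single_of_mem i hi, sq]
  intro j hj hji
  have hs := hπ i hi j hj (Ne.symm hji)
  by_cases h1 : r < i
  · rw [hlow r i h1, zero_mul]
  by_cases h2 : r < j
  · rw [hlow r j h2, mul_zero]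
  have h1' : (i : ℕ) ≤ r := not_lt.mp h1
  have h2' : (j : ℕ) ≤ r := not_lt.mp h2
  rcases le_abs.mp hs with h | h
  · rw [hband r j (le_abs.mpr (Or.inl (by omega))), mul_zero]
  · rw [hband r i (le_abs.mpr (Or.inl (by omega))), zero_mul]
end

section
/- Let C ∈ ℝ^{n×n} be lower-triangular and b-banded with every column of unit Euclidean norm (‖C[:,j]‖ = 1 for all j), and let k be a positive integer with (k−1)·b + 1 ≤ n. Then the supremum, over all d ≥ 1, all sets π ⊆ {1,…,n} with min-separation at least b and |π| ≤ k, and all matrices u ∈ ℝ^{n×d} whose rows outside π are zero and whose rows have Euclidean norm at most 1, of ‖C u‖_F equals exactly √k. -/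
open Matrix

theorem row_sq_aux {n b : ℕ} (C : Matrix (Fin n) (Fin n) ℝ)
    (hlow : _root_.IsLowerTriangular C) (hband : IsBanded b C)
    (π : Finset (Fin n)) (hπ : MinSep b π) (v : Fin n → ℝ)
    (hv : ∀ i, i ∉ π → v i = 0) (r : Fin n) :
    (∑ m, C r m * v m) ^ 2 = ∑ m, (C r m) ^ 2 * (v m) ^ 2 := by
  rw [sq, Finset.sum_mul_sum]
  refine Finset.sum_congr rfl fun m _ => ?_
  rw [Finset.sum_eq_single m]
  · ring
  · intro m' _ hne
    by_cases h1 : m ∈ π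
    · by_cases h2 : m' ∈ π
      · have hs := hπ m h1 m' h2 (Ne.symm hne)
        by_cases a1 : r < m
        · simp [hlow r m a1]
        by_cases a2 : r < m'
        · simp [hlow r m' a2]
        by_cases a3 : (b : ℤ) ≤ |((r : ℕ) : ℤ) - ((m : ℕ) : ℤ)|
        · simp [hband r m a3]
        by_cases a4 : (b : ℤ) ≤ |((r : ℕ) : ℤ) - ((m' : ℕ) : ℤ)|
        · simp [hband r m' a4]
        exfalso
        rw [Fin.lt_def] at a1 a2
        rw [le_abs] at hs a3 a4
        omega
      · simp [hv m' h2]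
    · simp [hv m h1]
  · simp

theorem frob_aux {n b d : ℕ} (C : Matrix (Fin n) (Fin n) ℝ)
    (hlow : _root_.IsLowerTriangular C) (hband : IsBanded b C)
    (hcols : ∀ j : Fin n, Real.sqrt (∑ r : Fin n, (C r j) ^ 2) = 1)
    (π : Finset (Fin n)) (hπ : MinSep b π) (u : Matrix (Fin n) (Fin d) ℝ)
    (hu : ∀ i : Fin n, i ∉ π → ∀ j : Fin d, u i j = 0) :
    ∑ i : Fin n, ∑ j : Fin d, ((C * u) i j) ^ 2 = ∑ m ∈ π, ∑ j, (u m j) ^ 2 := by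
  have hc : ∀ j : Fin n, ∑ r : Fin n, (C r j) ^ 2 = 1 := fun j => by
    simpa using hcols j
  have h1 : ∀ i j, ((C * u) i j) ^ 2 = ∑ m, (C i m) ^ 2 * (u m j) ^ 2 := fun i j => by
    rw [Matrix.mul_apply]
    exact row_sq_aux C hlow hband π hπ (fun m => u m j) (fun m hm => hu m hm j) i
  simp_rw [h1]
  rw [Finset.sum_comm]
  have h2 : ∀ j, ∑ i, ∑ m, (C i m) ^ 2 * (u m j) ^ 2 = ∑ m, (u m j) ^ 2 := fun j => by
    rw [Finset.sum_comm]
    simp_rw [← Finset.sum_mul, hc, one_mul]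
  simp_rw [h2]
  rw [Finset.sum_comm]
  symm
  apply Finset.sum_subset (Finset.subset_univ _)
  intro m _ hm
  simp [hu m hm]

/-- For a lower-triangular `b`-banded matrix `C` with unit-norm columns,
the sensitivity under `b`-min-sep participation with at most `k` participations (a
supremum over all dimensions `d`, patterns `π`, and row-bounded contributions `u`) is
exactly `√k`, provided `(k - 1) b + 1 ≤ n`. -/
theorem banded_sensitivity_exact {n b k : ℕ} (hb : 0 < b) (hk : 0 < k)
    (hn : (k - 1) * b + 1 ≤ n) (C : Matrix (Fin n) (Fin n) ℝ)
    (hlow : _root_.IsLowerTriangular C) (hband : IsBanded b C)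
    (hcols : ∀ j : Fin n, Real.sqrt (∑ r : Fin n, (C r j) ^ 2) = 1) :
    sSup {x : ℝ | ∃ d : ℕ, 0 < d ∧ ∃ π : Finset (Fin n), MinSep b π ∧ π.card ≤ k ∧
        ∃ u : Matrix (Fin n) (Fin d) ℝ,
          (∀ i : Fin n, i ∉ π → ∀ j : Fin d, u i j = 0) ∧
          (∀ i : Fin n, ∑ j : Fin d, (u i j) ^ 2 ≤ 1) ∧
          x = Real.sqrt (∑ i : Fin n, ∑ j : Fin d, ((C * u) i j) ^ 2)}
      = Real.sqrt k := by
  apply IsGreatest.csSup_eq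
  constructor
  · have hlt : ∀ t : Fin k, (t : ℕ) * b < n := fun t => by
      have : (t : ℕ) * b ≤ (k - 1) * b := Nat.mul_le_mul_right _ (by omega)
      omega
    have hinj : Function.Injective (fun t : Fin k => (⟨(t : ℕ) * b, hlt t⟩ : Fin n)) := by
      intro s t h
      simp only [Fin.mk.injEq] at h
      exact Fin.ext (Nat.eq_of_mul_eq_mul_right hb h)
    have hsep : MinSep b (Finset.univ.image
        (fun t : Fin k => (⟨(t : ℕ) * b, hlt t⟩ : Fin n))) := by
      intro i hi j hj hij
      simp only [Finset.mem_image, Finset.mem_univ, true_and] at hi hj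
      obtain ⟨s, rfl⟩ := hi
      obtain ⟨t, rfl⟩ := hj
      have hst : (s : ℕ) ≠ t := fun h => hij (by simp [h])
      simp only
      rw [le_abs]
      rcases Nat.lt_or_gt_of_ne hst with h | h
      · right
        have := Nat.mul_le_mul_right b (Nat.succ_le_of_lt h)
        rw [Nat.succ_mul] at this
        omega
      · left
        have := Nat.mul_le_mul_right b (Nat.succ_le_of_lt h)
        rw [Nat.succ_mul] at this
        omega
    have hcard : (Finset.univ.image
        (fun t : Fin k => (⟨(t : ℕ) * b, hlt t⟩ : Fin n))).card = k := by
      rw [Finset.card_image_of_injective _ hinj]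
      simp
    generalize (Finset.univ.image
        (fun t : Fin k => (⟨(t : ℕ) * b, hlt t⟩ : Fin n))) = π at hsep hcard
    have hu : ∀ i : Fin n, i ∉ π → ∀ j : Fin 1,
        (Matrix.of fun (i : Fin n) (_ : Fin 1) => if i ∈ π then (1 : ℝ) else 0) i j = 0 := by
      intro i hi j
      simp [hi]
    refine ⟨1, one_pos, π, hsep, hcard.le, _, hu, ?_, ?_⟩
    · intro i
      by_cases h : i ∈ π <;> simp [h]
    · rw [frob_aux C hlow hband hcols π hsep _ hu]
      congr 1
      simp [hcard]
  · rintro x ⟨d, -, π, hsep, hcard, u, hu, hrow, rfl⟩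
    rw [frob_aux C hlow hband hcols π hsep u hu]
    apply Real.sqrt_le_sqrt
    calc ∑ m ∈ π, ∑ j, (u m j) ^ 2 ≤ ∑ m ∈ π, (1 : ℝ) := Finset.sum_le_sum fun m _ => hrow m
      _ = (π.card : ℝ) := by simp
      _ ≤ k := by exact_mod_cast hcard
end

section
/- Let C ∈ ℝ^{n×n} be lower-triangular and b-banded, and let k′ be a positive integer. Let c_i = ‖C[:,i]‖² denote the squared Euclidean norm of column i. Then the supremum, over all d ≥ 1, all sets π ⊆ {1,…,n} with min-separation at least b and |π| ≤ k′, and all matrices u ∈ ℝ^{n×d} whose rows outside π are zero and whose rows have Euclidean norm at most 1, of ‖C u‖_F equals max over such π of sqrt( Σ_{i∈π} c_i ); moreover this maximum is attained at d = 1 by taking u to be the 0/1 indicator vector of a maximizing pattern π. -/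
open Matrix

/-- The exact `b`-min-sep sensitivity value for a banded `C`:
`max_π sqrt (Σ_{i∈π} ‖C[:,i]‖²)` over patterns with min-separation at least `b` and at
most `k'` elements. -/
noncomputable def bandedSensValue {n : ℕ} (b k' : ℕ) (C : Matrix (Fin n) (Fin n) ℝ) : ℝ :=
  sSup {y : ℝ | ∃ π : Finset (Fin n), MinSep b π ∧ π.card ≤ k' ∧
    y = Real.sqrt (∑ i ∈ π, ∑ r : Fin n, (C r i) ^ 2)}

/-- Distinct columns of a pattern have disjoint supports. -/
lemma banded_cols_disjoint {n b : ℕ} (C : Matrix (Fin n) (Fin n) ℝ)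
    (hlow : _root_.IsLowerTriangular C) (hband : IsBanded b C) (π : Finset (Fin n))
    (hπ : MinSep b π) (r i j : Fin n) (hi : i ∈ π) (hj : j ∈ π) (hij : i ≠ j) :
    C r i * C r j = 0 := by
  by_contra h
  have h1 : C r i ≠ 0 := left_ne_zero_of_mul h
  have h2 : C r j ≠ 0 := right_ne_zero_of_mul h
  have a1 : ¬ r < i := fun h => h1 (hlow r i h)
  have a2 : ¬ r < j := fun h => h2 (hlow r j h)
  have b1 := fun h => h1 (hband r i h)
  have b2 := fun h => h2 (hband r j h)
  have hs := hπ i hi j hj hij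
  rw [Fin.lt_def] at a1 a2
  rw [imp_false, not_le, abs_lt] at b1 b2
  rw [le_abs] at hs
  omega

/-- Pythagoras for a contribution supported on a pattern. -/
lemma banded_mul_sq_sum {n b d : ℕ} (C : Matrix (Fin n) (Fin n) ℝ)
    (hlow : _root_.IsLowerTriangular C) (hband : IsBanded b C) (π : Finset (Fin n))
    (hπ : MinSep b π) (u : Matrix (Fin n) (Fin d) ℝ)
    (hu : ∀ i : Fin n, i ∉ π → ∀ j : Fin d, u i j = 0) :
    ∑ r : Fin n, ∑ j : Fin d, ((C * u) r j) ^ 2 =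
      ∑ i ∈ π, (∑ r : Fin n, (C r i) ^ 2) * ∑ j : Fin d, (u i j) ^ 2 := by
  have key : ∀ r j, ((C * u) r j) ^ 2 = ∑ i ∈ π, (C r i) ^ 2 * (u i j) ^ 2 := by
    intro r j
    have h1 : (C * u) r j = ∑ i ∈ π, C r i * u i j := by
      rw [Matrix.mul_apply]
      symm
      apply Finset.sum_subset (Finset.subset_univ _)
      intro i _ hi
      rw [hu i hi j, mul_zero]
    rw [h1, sq, Finset.sum_mul_sum]
    apply Finset.sum_congr rfl
    intro i hi
    rw [Finset.sum_eq_single_of_mem i hi]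
    · ring
    · intro l hl hli
      have := banded_cols_disjoint C hlow hband π hπ r i l hi hl (Ne.symm hli)
      linear_combination (u i j * u l j) * this
  simp_rw [key, Finset.sum_mul_sum]
  rw [Finset.sum_comm (s := π)]
  apply Finset.sum_congr rfl
  intro r _
  rw [Finset.sum_comm]

/-- For a lower-triangular `b`-banded `C`, the supremum of `‖C u‖_F`
over all dimensions `d ≥ 1`, patterns `π` with min-separation at least `b` and
`|π| ≤ k'`, and contributions `u` supported on `π` with rows of norm at most `1`, equals
`max_π sqrt (Σ_{i∈π} c_i)` where `c_i = ‖C[:,i]‖²`; moreover the maximum is attained at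
`d = 1` by the 0/1 indicator vector of a maximizing pattern. -/
theorem banded_minsep_sensitivity_exact {n b k' : ℕ} (hb : 0 < b) (hk' : 0 < k')
    (C : Matrix (Fin n) (Fin n) ℝ) (hlow : _root_.IsLowerTriangular C) (hband : IsBanded b C) :
    (∀ d : ℕ, 0 < d → ∀ π : Finset (Fin n), MinSep b π → π.card ≤ k' →
      ∀ u : Matrix (Fin n) (Fin d) ℝ,
        (∀ i : Fin n, i ∉ π → ∀ j : Fin d, u i j = 0) →
        (∀ i : Fin n, ∑ j : Fin d, (u i j) ^ 2 ≤ 1) →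
        Real.sqrt (∑ i : Fin n, ∑ j : Fin d, ((C * u) i j) ^ 2) ≤
          bandedSensValue b k' C) ∧
    (∃ π : Finset (Fin n), MinSep b π ∧ π.card ≤ k' ∧
      Real.sqrt (∑ i : Fin n, ∑ j : Fin 1,
          ((C * Matrix.of (fun i (_ : Fin 1) => if i ∈ π then (1 : ℝ) else 0)) i j) ^ 2)
        = bandedSensValue b k' C) := by
  have hfin : {y : ℝ | ∃ π : Finset (Fin n), MinSep b π ∧ π.card ≤ k' ∧
      y = Real.sqrt (∑ i ∈ π, ∑ r : Fin n, (C r i) ^ 2)}.Finite := by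
    apply (Set.finite_range (fun π : Finset (Fin n) =>
      Real.sqrt (∑ i ∈ π, ∑ r : Fin n, (C r i) ^ 2))).subset
    rintro y ⟨π, _, _, rfl⟩
    exact ⟨π, rfl⟩
  have hne : {y : ℝ | ∃ π : Finset (Fin n), MinSep b π ∧ π.card ≤ k' ∧
      y = Real.sqrt (∑ i ∈ π, ∑ r : Fin n, (C r i) ^ 2)}.Nonempty :=
    ⟨_, ∅, by intro i hi; simp at hi, by simp, rfl⟩
  constructor
  · intro d _ π hπ hcard u hu hrow
    refine le_trans ?_ (le_csSup hfin.bddAbove ⟨π, hπ, hcard, rfl⟩)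
    apply Real.sqrt_le_sqrt
    rw [banded_mul_sq_sum C hlow hband π hπ u hu]
    apply Finset.sum_le_sum
    intro i _
    exact mul_le_of_le_one_right (Finset.sum_nonneg fun _ _ => sq_nonneg _) (hrow i)
  · obtain ⟨π, hπ, hcard, hy⟩ := hne.csSup_mem hfin
    refine ⟨π, hπ, hcard, ?_⟩
    rw [bandedSensValue, hy, banded_mul_sq_sum C hlow hband π hπ _ (by
      intro i hi j
      simp [hi])]
    congr 1
    apply Finset.sum_congr rfl
    intro i hi
    simp [hi]
end
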